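/- Let A be a C*-algebra, let S be a nonempty set of positive linear functionals on A each of norm at most 1, let a ∈ A with 0 ≤ a ≤ 1, and let δ ∈ (0, 1/2). Then for every ε > 0 there exist η with 0 < η < δ/2 and an integer n₀ ≥ 1 such that sup_{τ∈S} ( τ(f_η(a)) − d_τ(f_δ(a)) ) ≥ ω(a)|_S − ε and sup_{τ∈S} ( τ(a^{1/n₀}) − d_τ(f_δ(a)) ) ≥ ω(a)|_S − ε, where a^{1/n₀} is given by continuous functional calculus. -/

import Mathlib

open scoped ComplexOrder

/-- The cut-off function `f_ε : ℝ → ℝ`: it is `0` on `(-∞, ε/2]`, `1` on `[ε, ∞)`,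
and linear on `[ε/2, ε]` (for `ε > 0`). -/
noncomputable def fcut (ε : ℝ) : ℝ → ℝ := fun t => min 1 (max 0 ((t - ε / 2) / (ε / 2)))

variable {A : Type*} [NonUnitalCStarAlgebra A] [PartialOrder A] [StarOrderedRing A]

/-- The hereditary C*-subalgebra generated by `a`, as a subset of `A`:
the norm closure of `{a x a : x ∈ A}`. -/
def herSet (a : A) : Set A := closure {y : A | ∃ x : A, y = a * x * a}

/-- `d_τ(a) = sup_{ε > 0} τ(f_ε(a))`, the rank of `a` at the positive functional `τ`. -/
noncomputable def dtau (τ : A →L[ℂ] ℂ) (a : A) : ℝ :=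
  sSup {r : ℝ | ∃ ε : ℝ, 0 < ε ∧ r = (τ (cfcₙ (fcut ε) a)).re}

/-- The tracial oscillation `ω(a)|_S` of a positive element `a` on a set `S` of
positive functionals:
`inf { sup_{τ ∈ S} (d_τ(a) − τ(c)) : c ∈ Her(a), 0 ≤ c ≤ 1 }`. -/
noncomputable def osc (S : Set (A →L[ℂ] ℂ)) (a : A) : ℝ :=
  sInf {r : ℝ | ∃ c ∈ herSet a, 0 ≤ c ∧ ‖c‖ ≤ 1 ∧
    r = sSup {s : ℝ | ∃ τ ∈ S, s = dtau τ a - (τ c).re}}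

lemma continuous_fcut (ε : ℝ) : Continuous (fcut ε) := by
  unfold fcut
  fun_prop

lemma fcut_nonneg (ε t : ℝ) : 0 ≤ fcut ε t :=
  le_min zero_le_one (le_max_left _ _)

lemma fcut_le_one (ε t : ℝ) : fcut ε t ≤ 1 := min_le_left _ _

lemma fcut_eq_zero {ε t : ℝ} (hε : 0 < ε) (ht : t ≤ ε / 2) : fcut ε t = 0 := by
  have : (t - ε / 2) / (ε / 2) ≤ 0 := div_nonpos_of_nonpos_of_nonneg (by linarith) (by linarith)
  simp [fcut, max_eq_left this]

lemma fcut_eq_one {ε t : ℝ} (hε : 0 < ε) (ht : ε ≤ t) : fcut ε t = 1 := by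
  have : 1 ≤ (t - ε / 2) / (ε / 2) := by
    rw [le_div_iff₀ (by linarith)]
    linarith
  exact min_eq_left (this.trans (le_max_right _ _))

lemma fcut_zero {ε : ℝ} (hε : 0 < ε) : fcut ε 0 = 0 := fcut_eq_zero hε (by linarith)

lemma fcut_antitone {η ε t : ℝ} (hη : 0 < η) (h : η ≤ ε) (ht : 0 ≤ t) :
    fcut ε t ≤ fcut η t := by
  have key : (t - ε / 2) / (ε / 2) ≤ (t - η / 2) / (η / 2) := by
    rw [div_le_div_iff₀ (by linarith) (by linarith)]
    nlinarith
  exact min_le_min le_rfl (max_le_max le_rfl key)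

/-- Every cut-off of `fcut δ` stays below `fcut (δ / 2)`. -/
lemma fcut_comp_fcut_le {ε δ : ℝ} (hε : 0 < ε) (hδ : 0 < δ) (t : ℝ) :
    fcut ε (fcut δ t) ≤ fcut (δ / 2) t := by
  rcases le_total t (δ / 2) with h | h
  · rw [fcut_eq_zero hδ h, fcut_zero hε]
    exact fcut_nonneg _ _
  · rw [fcut_eq_one (half_pos hδ) h]
    exact fcut_le_one _ _

lemma rpow_mul_fcut_le {η p t : ℝ} (hη : 0 < η) (hp : 0 ≤ p) (ht : 0 ≤ t) :
    (η / 2) ^ p * fcut η t ≤ t ^ p := by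
  rcases le_total t (η / 2) with h | h
  · rw [fcut_eq_zero hη h, mul_zero]
    positivity
  · calc (η / 2) ^ p * fcut η t ≤ (η / 2) ^ p * 1 := by
          gcongr
          exact fcut_le_one _ _
      _ ≤ t ^ p := by
          rw [mul_one]
          gcongr

lemma norm_cfcₙ_fcut_le {B : Type*} [NonUnitalCStarAlgebra B] (ε : ℝ) (a : B) :
    ‖cfcₙ (fcut ε) a‖ ≤ 1 :=
  norm_cfcₙ_le fun t _ => by
    rw [Real.norm_of_nonneg (fcut_nonneg _ _)]
    exact fcut_le_one _ _

lemma cfcₙ_fcut_nonneg (ε : ℝ) (a : A) : 0 ≤ cfcₙ (fcut ε) a :=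
  cfcₙ_nonneg fun t _ => fcut_nonneg ε t

lemma cfcₙ_fcut_mem_herSet {ε : ℝ} (hε : 0 < ε) {a : A} (ha : 0 ≤ a) :
    cfcₙ (fcut ε) a ∈ herSet a := by
  have hsa : IsSelfAdjoint a := .of_nonneg ha
  set g : ℝ → ℝ := fun t => fcut ε t / (max t (ε / 2)) ^ 2
  have hpos : ∀ t : ℝ, 0 < max t (ε / 2) := fun t => lt_max_of_lt_right (half_pos hε)
  have hg : Continuous g :=
    (continuous_fcut ε).div (by fun_prop) fun t => (pow_pos (hpos t) 2).ne'
  have hg0 : g 0 = 0 := by simp [g, fcut_zero hε]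
  have hfg : fcut ε = fun t => t * g t * t := by
    funext t
    rcases le_total t (ε / 2) with h | h
    · simp [g, fcut_eq_zero hε h]
    · have ht : t ≠ 0 := by linarith
      simp only [g, max_eq_left h]
      field_simp
  refine subset_closure ⟨cfcₙ g a, ?_⟩
  rw [hfg, cfcₙ_mul (fun t => t * g t) (fun t => t) a (by fun_prop) (by simp) (by fun_prop) rfl,
    cfcₙ_mul (fun t => t) g a (by fun_prop) rfl (by fun_prop) hg0, cfcₙ_id' ℝ a]

section Functional

variable {B : Type*} [NonUnitalCStarAlgebra B] {τ : B →L[ℂ] ℂ}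

lemma abs_re_apply_le (hτ : ‖τ‖ ≤ 1) (x : B) : |(τ x).re| ≤ ‖x‖ :=
  (Complex.abs_re_le_norm _).trans (τ.le_of_opNorm_le hτ x |>.trans_eq (one_mul _))

lemma re_apply_cfcₙ_fcut_le_one (hτ : ‖τ‖ ≤ 1) (ε : ℝ) (a : B) :
    (τ (cfcₙ (fcut ε) a)).re ≤ 1 :=
  (le_abs_self _).trans ((abs_re_apply_le hτ _).trans (norm_cfcₙ_fcut_le ε a))

lemma dtau_le {a : B} {b : ℝ} (h : ∀ ε : ℝ, 0 < ε → (τ (cfcₙ (fcut ε) a)).re ≤ b) :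
    dtau τ a ≤ b := by
  refine csSup_le ⟨_, 1, one_pos, rfl⟩ ?_
  rintro _ ⟨ε, hε, rfl⟩
  exact h ε hε

lemma dtau_le_one (hτ : ‖τ‖ ≤ 1) (a : B) : dtau τ a ≤ 1 :=
  dtau_le fun ε _ => re_apply_cfcₙ_fcut_le_one hτ ε a

lemma bddAbove_dtau_sub {S : Set (B →L[ℂ] ℂ)} (hSnorm : ∀ τ ∈ S, ‖τ‖ ≤ 1) (a c : B) :
    BddAbove {s : ℝ | ∃ τ ∈ S, s = dtau τ a - (τ c).re} := by
  refine ⟨1 + ‖c‖, ?_⟩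
  rintro _ ⟨τ, hτ, rfl⟩
  linarith [dtau_le_one (hSnorm τ hτ) a, (abs_le.mp (abs_re_apply_le (hSnorm τ hτ) c)).1]

end Functional

section PositiveFunctional

variable {τ : A →L[ℂ] ℂ}

lemma re_apply_nonneg (hτ : ∀ x : A, 0 ≤ τ (star x * x)) {x : A} (hx : 0 ≤ x) :
    0 ≤ (τ x).re := by
  obtain ⟨y, rfl⟩ := CStarAlgebra.nonneg_iff_eq_star_mul_self.mp hx
  exact (Complex.le_def.mp (hτ y)).1

lemma re_apply_mono (hτ : ∀ x : A, 0 ≤ τ (star x * x)) {x y : A} (h : x ≤ y) :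
    (τ x).re ≤ (τ y).re := by
  simpa using re_apply_nonneg hτ (sub_nonneg.mpr h)

lemma dtau_nonneg (hτ : ∀ x : A, 0 ≤ τ (star x * x)) (a : A) : 0 ≤ dtau τ a := by
  apply Real.sSup_nonneg
  rintro _ ⟨ε, -, rfl⟩
  exact re_apply_nonneg hτ (cfcₙ_fcut_nonneg ε a)

lemma re_apply_cfcₙ_fcut_antitone (hτ : ∀ x : A, 0 ≤ τ (star x * x)) {a : A} (ha : 0 ≤ a)
    {η ε : ℝ} (hη : 0 < η) (h : η ≤ ε) :
    (τ (cfcₙ (fcut ε) a)).re ≤ (τ (cfcₙ (fcut η) a)).re :=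
  re_apply_mono hτ <| cfcₙ_mono
    (fun t ht => fcut_antitone hη h (quasispectrum_nonneg_of_nonneg a ha t ht))
    (continuous_fcut ε).continuousOn (continuous_fcut η).continuousOn
    (fcut_zero (hη.trans_le h)) (fcut_zero hη)

lemma dtau_cfcₙ_fcut_le (hτ : ∀ x : A, 0 ≤ τ (star x * x)) {a : A} (ha : 0 ≤ a)
    {δ : ℝ} (hδ : 0 < δ) :
    dtau τ (cfcₙ (fcut δ) a) ≤ (τ (cfcₙ (fcut (δ / 2)) a)).re := by
  refine dtau_le fun ε hε => re_apply_mono hτ ?_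
  rw [← cfcₙ_comp (fcut ε) (fcut δ) a (continuous_fcut ε).continuousOn (fcut_zero hε)
    (continuous_fcut δ).continuousOn (fcut_zero hδ) (.of_nonneg ha)]
  exact cfcₙ_mono (fun t _ => fcut_comp_fcut_le hε hδ t)
    ((continuous_fcut ε).comp (continuous_fcut δ)).continuousOn
    (continuous_fcut _).continuousOn (by simp [fcut_zero hδ, fcut_zero hε])
    (fcut_zero (half_pos hδ))

/-- The value `dtau τ a` is approximated by `τ (f_η(a))` for arbitrarily small `η`. -/
lemma exists_lt_re_apply_cfcₙ_fcut (hτ : ∀ x : A, 0 ≤ τ (star x * x)) {a : A} (ha : 0 ≤ a)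
    {b κ : ℝ} (hκ : 0 < κ) (hb : b < dtau τ a) :
    ∃ η : ℝ, 0 < η ∧ η < κ ∧ b < (τ (cfcₙ (fcut η) a)).re := by
  obtain ⟨_, ⟨ε, hε, rfl⟩, h⟩ := exists_lt_of_lt_csSup (by exact ⟨_, 1, one_pos, rfl⟩) hb
  have hη : 0 < min ε (κ / 2) := lt_min hε (half_pos hκ)
  exact ⟨min ε (κ / 2), hη, (min_le_right _ _).trans_lt (half_lt_self hκ),
    h.trans_le (re_apply_cfcₙ_fcut_antitone hτ ha hη (min_le_left _ _))⟩

lemma rpow_mul_re_apply_cfcₙ_fcut_le (hτ : ∀ x : A, 0 ≤ τ (star x * x)) {a : A} (ha : 0 ≤ a)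
    {η p : ℝ} (hη : 0 < η) (hp : 0 < p) :
    (η / 2) ^ p * (τ (cfcₙ (fcut η) a)).re ≤ (τ (cfcₙ (fun t : ℝ => t ^ p) a)).re := by
  have hle : (η / 2) ^ p • cfcₙ (fcut η) a ≤ cfcₙ (fun t : ℝ => t ^ p) a := by
    rw [← cfcₙ_const_mul _ _ a (continuous_fcut η).continuousOn (fcut_zero hη)]
    exact cfcₙ_mono
      (fun t ht => rpow_mul_fcut_le hη hp.le (quasispectrum_nonneg_of_nonneg a ha t ht))
      ((continuous_fcut η).const_mul _ |>.continuousOn)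
      (Real.continuous_rpow_const hp.le).continuousOn
      (by simp [fcut_zero hη]) (Real.zero_rpow hp.ne')
  have := re_apply_mono hτ hle
  rwa [← Complex.coe_smul, map_smul, smul_eq_mul, Complex.re_ofReal_mul] at this

end PositiveFunctional

lemma exists_lt_rpow_inv {x b : ℝ} (hx : 0 < x) (hb : b < 1) :
    ∃ n : ℕ, 1 ≤ n ∧ b < x ^ ((n : ℝ)⁻¹) := by
  have hlim : Filter.Tendsto (fun n : ℕ => x ^ ((n : ℝ)⁻¹)) Filter.atTop (nhds 1) := by
    simpa [Function.comp_def] using (Real.continuousAt_const_rpow hx.ne').tendsto.comp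
      (tendsto_inv_atTop_nhds_zero_nat (𝕜 := ℝ))
  obtain ⟨n, hn, hn1⟩ := ((hlim.eventually_const_lt hb).and (Filter.eventually_ge_atTop 1)).exists
  exact ⟨n, hn1, hn⟩

section Oscillation

variable {S : Set (A →L[ℂ] ℂ)}

lemma le_sSup_re_sub_dtau (hSpos : ∀ τ ∈ S, ∀ x : A, 0 ≤ τ (star x * x))
    (hSnorm : ∀ τ ∈ S, ‖τ‖ ≤ 1) (x y : A) {τ : A →L[ℂ] ℂ} (hτ : τ ∈ S) :
    (τ x).re - dtau τ y ≤ sSup {s : ℝ | ∃ τ ∈ S, s = (τ x).re - dtau τ y} := by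
  refine le_csSup ⟨‖x‖, ?_⟩ ⟨τ, hτ, rfl⟩
  rintro _ ⟨σ, hσ, rfl⟩
  linarith [dtau_nonneg (hSpos σ hσ) y, le_of_abs_le (abs_re_apply_le (hSnorm σ hσ) x)]

lemma osc_le (hSne : S.Nonempty) (hSpos : ∀ τ ∈ S, ∀ x : A, 0 ≤ τ (star x * x))
    (hSnorm : ∀ τ ∈ S, ‖τ‖ ≤ 1) {a c : A} (hc : c ∈ herSet a) (hc0 : 0 ≤ c) (hc1 : ‖c‖ ≤ 1) :
    osc S a ≤ sSup {s : ℝ | ∃ τ ∈ S, s = dtau τ a - (τ c).re} := by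
  refine csInf_le ⟨-1, ?_⟩ ⟨c, hc, hc0, hc1, rfl⟩
  rintro _ ⟨d, -, -, hd1, rfl⟩
  obtain ⟨τ, hτ⟩ := hSne
  refine le_csSup_of_le (bddAbove_dtau_sub hSnorm a d) ⟨τ, hτ, rfl⟩ ?_
  linarith [dtau_nonneg (hSpos τ hτ) a, le_of_abs_le (abs_re_apply_le (hSnorm τ hτ) d)]

end Oscillation

/-- Proposition 4.4 of the paper.  Let `S` be a nonempty set of positive
linear functionals of norm at most `1` on a C*-algebra `A`, let `0 ≤ a ≤ 1` and
`δ ∈ (0, 1/2)`.  Then for every `ε > 0` there exist `0 < η < δ/2` and `n₀ ≥ 1` with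
`sup_{τ∈S} (τ(f_η(a)) − d_τ(f_δ(a))) ≥ ω(a)|_S − ε` and
`sup_{τ∈S} (τ(a^{1/n₀}) − d_τ(f_δ(a))) ≥ ω(a)|_S − ε`. -/
theorem stmt3 (S : Set (A →L[ℂ] ℂ)) (hSne : S.Nonempty)
    (hSpos : ∀ τ ∈ S, ∀ x : A, 0 ≤ τ (star x * x))
    (hSnorm : ∀ τ ∈ S, ‖τ‖ ≤ 1)
    (a : A) (ha : 0 ≤ a) (ha1 : ‖a‖ ≤ 1)
    (δ : ℝ) (hδ0 : 0 < δ) (hδ : δ < 1 / 2) :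
    ∀ ε > 0, ∃ η : ℝ, 0 < η ∧ η < δ / 2 ∧ ∃ n₀ : ℕ, 1 ≤ n₀ ∧
      osc S a - ε ≤
        sSup {s : ℝ | ∃ τ ∈ S, s = (τ (cfcₙ (fcut η) a)).re - dtau τ (cfcₙ (fcut δ) a)} ∧
      osc S a - ε ≤
        sSup {s : ℝ | ∃ τ ∈ S,
          s = (τ (cfcₙ (fun t : ℝ => t ^ ((n₀ : ℝ)⁻¹)) a)).re - dtau τ (cfcₙ (fcut δ) a)} := by
  intro ε hε
  have hω := osc_le hSne hSpos hSnorm (cfcₙ_fcut_mem_herSet (half_pos hδ0) ha)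
    (cfcₙ_fcut_nonneg (δ / 2) a) (norm_cfcₙ_fcut_le (δ / 2) a)
  obtain ⟨_, ⟨τ, hτ, rfl⟩, hlt⟩ := exists_lt_of_lt_csSup
    (by exact hSne.elim fun τ hτ => ⟨_, τ, hτ, rfl⟩) ((sub_lt_self _ (by linarith : 0 < ε / 3)).trans_le hω)
  have hd := dtau_cfcₙ_fcut_le (hSpos τ hτ) ha hδ0
  obtain ⟨η, hη0, hηδ, hη⟩ := exists_lt_re_apply_cfcₙ_fcut (hSpos τ hτ) ha (half_pos hδ0)
    (sub_lt_self (dtau τ a) (by linarith : 0 < ε / 3))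
  obtain ⟨n, hn1, hn⟩ := exists_lt_rpow_inv (half_pos hη0) (by linarith : 1 - ε / 3 < 1)
  have hpow := rpow_mul_re_apply_cfcₙ_fcut_le (hSpos τ hτ) ha hη0
    (inv_pos.mpr (Nat.cast_pos.mpr hn1) : 0 < (n : ℝ)⁻¹)
  have h0 := re_apply_nonneg (hSpos τ hτ) (cfcₙ_fcut_nonneg η a)
  have h1 := re_apply_cfcₙ_fcut_le_one (hSnorm τ hτ) η a
  refine ⟨η, hη0, hηδ, n, hn1, ?_, ?_⟩
  · refine le_trans ?_ (le_sSup_re_sub_dtau hSpos hSnorm _ _ hτ)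
    linarith
  · refine le_trans ?_ (le_sSup_re_sub_dtau hSpos hSnorm _ _ hτ)
    have := mul_le_mul_of_nonneg_right hn.le h0
    nlinarith
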